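/- arXiv:math/0411129 — 4 statements merged into one kernel-verified Lean document; each statement's English description precedes it below -/
import Mathlib

section
/- Let A and B be rings, M a finitely generated projective right A-module, N a B-A-bimodule, and U a left B-module. Write Hom(_B N, _B U) for the left B-linear additive maps N → U, regarded as a left A-module via (a·φ)(n) = φ(n·a), and Hom(M_A, N_A) for the right A-linear maps M → N, regarded as a left B-module via postcomposition with the B-action on N. Then the additive map M ⊗_A Hom(_B N, _B U) → Hom(_B Hom(M_A, N_A), _B U) sending m⊗φ to the map ν ↦ φ(ν(m)) is well defined and bijective. -/
noncomputable section

open TensorProduct MulOpposite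

section

variable {A B M N U : Type*}
variable [Ring A] [Ring B]
variable [AddCommGroup M] [Module Aᵐᵒᵖ M]
variable [AddCommGroup N] [Module B N] [Module Aᵐᵒᵖ N] [SMulCommClass B Aᵐᵒᵖ N]
variable [AddCommGroup U] [Module B U]

/-- Right multiplication by `a : A` on the `B`-`A`-bimodule `N`, as a left `B`-linear map. -/
def rsmulN (a : A) : N →ₗ[B] N where
  toFun n := op a • n
  map_add' x y := smul_add (op a) x y
  map_smul' b n := (smul_comm b (op a) n).symm

/-- The left `B`-action on `Hom(M_A, N_A)` given by postcomposition with the `B`-action on `N`. -/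
def bsmulHom (b : B) (ν : M →ₗ[Aᵐᵒᵖ] N) : M →ₗ[Aᵐᵒᵖ] N where
  toFun m := b • ν m
  map_add' x y := by simp
  map_smul' c x := by
    simp only [map_smul, RingHom.id_apply]
    exact smul_comm b c (ν x)

/-- `Hom(_B Hom(M_A, N_A), _B U)`: additive maps that are left `B`-linear for the action
`(b • ν) m = b • (ν m)` on `Hom(M_A, N_A)` and the given action on `U`. -/
def TargetHom (A B M N U : Type*) [Ring A] [Ring B]
    [AddCommGroup M] [Module Aᵐᵒᵖ M]
    [AddCommGroup N] [Module B N] [Module Aᵐᵒᵖ N] [SMulCommClass B Aᵐᵒᵖ N]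
    [AddCommGroup U] [Module B U] : AddSubgroup ((M →ₗ[Aᵐᵒᵖ] N) →+ U) where
  carrier := {G | ∀ (b : B) (ν : M →ₗ[Aᵐᵒᵖ] N), G (bsmulHom b ν) = b • G ν}
  add_mem' := by
    intro G G' hG hG' b ν
    simp [hG b ν, hG' b ν, smul_add]
  zero_mem' := by intro b ν; simp
  neg_mem' := by
    intro G hG b ν
    simp [hG b ν]

/-- The `A`-balancing relations in `M ⊗_ℤ Hom(_B N, _B U)`, realizing `M ⊗_A Hom(_B N, _B U)`
as the quotient of the tensor product of abelian groups. -/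
def rel0 (A B M N U : Type*) [Ring A] [Ring B]
    [AddCommGroup M] [Module Aᵐᵒᵖ M]
    [AddCommGroup N] [Module B N] [Module Aᵐᵒᵖ N] [SMulCommClass B Aᵐᵒᵖ N]
    [AddCommGroup U] [Module B U] : AddSubgroup (M ⊗[ℤ] (N →ₗ[B] U)) :=
  AddSubgroup.closure
    {z | ∃ (m : M) (a : A) (φ : N →ₗ[B] U),
      z = (op a • m) ⊗ₜ[ℤ] φ - m ⊗ₜ[ℤ] (φ ∘ₗ rsmulN a)}

/-- A right `A`-linear functional `c` on `M` and `n : N` give the map `m ↦ n · c m`. -/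
def functionalSMul (c : M →ₗ[Aᵐᵒᵖ] Aᵐᵒᵖ) : N →+ (M →ₗ[Aᵐᵒᵖ] N) where
  toFun n := c.smulRight n
  map_zero' := by ext; simp
  map_add' x y := by ext; simp

/-- The left `B`-linear map `n ↦ G (m ↦ n · c m)` attached to a functional `c` on `M`. -/
def TargetHom.restrict (c : M →ₗ[Aᵐᵒᵖ] Aᵐᵒᵖ) :
    TargetHom A B M N U →+ (N →ₗ[B] U) where
  toFun G :=
    { toFun := fun n => (G : (M →ₗ[Aᵐᵒᵖ] N) →+ U) (functionalSMul c n)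
      map_add' := fun x y => by simp
      map_smul' := fun b n => by
        rw [RingHom.id_apply, ← G.2 b]
        congr 1
        ext m
        exact (smul_comm b (c m) n).symm }
  map_zero' := by ext; simp
  map_add' G G' := by ext; simp

theorem TargetHom.restrict_apply (c : M →ₗ[Aᵐᵒᵖ] Aᵐᵒᵖ) (G : TargetHom A B M N U) (n : N) :
    TargetHom.restrict c G n = (G : (M →ₗ[Aᵐᵒᵖ] N) →+ U) (c.smulRight n) :=
  rfl

/-- Evaluation `m ⊗ φ ↦ (ν ↦ φ (ν m))` on the tensor product of abelian groups. -/
def tensorEval (A B M N U : Type*) [Ring A] [Ring B]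
    [AddCommGroup M] [Module Aᵐᵒᵖ M]
    [AddCommGroup N] [Module B N] [Module Aᵐᵒᵖ N] [SMulCommClass B Aᵐᵒᵖ N]
    [AddCommGroup U] [Module B U] :
    M ⊗[ℤ] (N →ₗ[B] U) →+ TargetHom A B M N U :=
  TensorProduct.liftAddHom
    (AddMonoidHom.mk' (fun m => AddMonoidHom.mk' (fun φ =>
        ⟨AddMonoidHom.mk' (fun ν => φ (ν m)) (fun ν ν' => by simp),
          fun b ν => φ.map_smul b (ν m)⟩)
        (fun φ φ' => by ext; simp))
      (fun m m' => by ext; simp))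
    (fun r m φ => by ext; simp)

theorem tensorEval_tmul_apply (m : M) (φ : N →ₗ[B] U) (ν : M →ₗ[Aᵐᵒᵖ] N) :
    (tensorEval A B M N U (m ⊗ₜ φ) : (M →ₗ[Aᵐᵒᵖ] N) →+ U) ν = φ (ν m) :=
  rfl

theorem rel0_le_ker_tensorEval : rel0 A B M N U ≤ (tensorEval A B M N U).ker := by
  refine (AddSubgroup.closure_le _).2 ?_
  rintro _ ⟨m, a, φ, rfl⟩
  rw [SetLike.mem_coe, AddMonoidHom.mem_ker, map_sub, sub_eq_zero]
  ext ν
  rw [tensorEval_tmul_apply, tensorEval_tmul_apply, map_smul]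
  rfl

theorem mk_smul_tmul (m : M) (a : Aᵐᵒᵖ) (φ : N →ₗ[B] U) :
    QuotientAddGroup.mk' (rel0 A B M N U) ((a • m) ⊗ₜ φ) =
      QuotientAddGroup.mk' (rel0 A B M N U) (m ⊗ₜ (φ ∘ₗ rsmulN a.unop)) := by
  rw [← sub_eq_zero, ← map_sub]
  exact (QuotientAddGroup.eq_zero_iff _).2 (AddSubgroup.subset_closure ⟨m, a.unop, φ, rfl⟩)

/-- A finitely generated projective module has a finite dual basis. -/
theorem exists_finite_dual_basis (R P : Type*) [Ring R] [AddCommGroup P] [Module R P]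
    [Module.Finite R P] [Module.Projective R P] :
    ∃ (n : ℕ) (e : Fin n → P) (c : Fin n → P →ₗ[R] R), ∀ p, ∑ i, c i p • e i = p := by
  obtain ⟨n, f, g, -, -, h⟩ := Module.Finite.exists_comp_eq_id_of_projective R P
  refine ⟨n, fun i => f (Pi.single i 1), fun i => LinearMap.proj i ∘ₗ g, fun p => ?_⟩
  conv_rhs => rw [← LinearMap.id_apply (R := R) p, ← h, LinearMap.comp_apply,
    pi_eq_sum_univ' (g p), map_sum]
  simp [← map_smul, ← Pi.single_smul]

/-- The map `G ↦ ∑ i, e i ⊗ (n ↦ G (m ↦ n · c i m))`; it inverts `tensorEval` modulo `rel0`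
when `e`, `c` is a dual basis. -/
def tensorOfHom {n : ℕ} (e : Fin n → M) (c : Fin n → M →ₗ[Aᵐᵒᵖ] Aᵐᵒᵖ) :
    TargetHom A B M N U →+ M ⊗[ℤ] (N →ₗ[B] U) :=
  ∑ i, (TensorProduct.mk ℤ M (N →ₗ[B] U) (e i)).toAddMonoidHom.comp (TargetHom.restrict (c i))

theorem tensorOfHom_apply {n : ℕ} (e : Fin n → M) (c : Fin n → M →ₗ[Aᵐᵒᵖ] Aᵐᵒᵖ)
    (G : TargetHom A B M N U) :
    tensorOfHom e c G = ∑ i, e i ⊗ₜ[ℤ] TargetHom.restrict (c i) G := by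
  simp [tensorOfHom]

theorem tensorEval_tensorOfHom {n : ℕ} {e : Fin n → M} {c : Fin n → M →ₗ[Aᵐᵒᵖ] Aᵐᵒᵖ}
    (h : ∀ m, ∑ i, c i m • e i = m) (G : TargetHom A B M N U) :
    tensorEval A B M N U (tensorOfHom e c G) = G := by
  ext ν
  have hν : ∑ i, (c i).smulRight (ν (e i)) = ν := by
    ext m
    conv_rhs => rw [← h m, map_sum]
    simp
  conv_rhs => rw [← hν, map_sum]
  simp [tensorOfHom_apply, tensorEval_tmul_apply, TargetHom.restrict_apply]

theorem mk_tensorOfHom_tensorEval {n : ℕ} {e : Fin n → M} {c : Fin n → M →ₗ[Aᵐᵒᵖ] Aᵐᵒᵖ}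
    (h : ∀ m, ∑ i, c i m • e i = m) (z : M ⊗[ℤ] (N →ₗ[B] U)) :
    QuotientAddGroup.mk' (rel0 A B M N U) (tensorOfHom e c (tensorEval A B M N U z)) =
      QuotientAddGroup.mk' (rel0 A B M N U) z := by
  induction z with
  | zero => simp only [map_zero]
  | add x y hx hy => simp only [map_add, hx, hy]
  | tmul m φ =>
    conv_rhs => rw [← h m, TensorProduct.sum_tmul, map_sum]
    rw [tensorOfHom_apply, map_sum]
    refine Finset.sum_congr rfl fun i _ => ?_
    rw [mk_smul_tmul]
    rfl

/-- if `M` is a finitely generated projective right `A`-module, `N` a `B`-`A`-bimodule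
and `U` a left `B`-module, then the additive map
`M ⊗_A Hom(_B N, _B U) → Hom(_B Hom(M_A, N_A), _B U)`, `m ⊗ φ ↦ (ν ↦ φ (ν m))`,
is well defined and bijective. -/
theorem statement0 [Module.Finite Aᵐᵒᵖ M] [Module.Projective Aᵐᵒᵖ M] :
    ∃ Φ : (M ⊗[ℤ] (N →ₗ[B] U)) ⧸ (rel0 A B M N U) →+ TargetHom A B M N U,
      (∀ (m : M) (φ : N →ₗ[B] U) (ν : M →ₗ[Aᵐᵒᵖ] N),
        ((Φ ((QuotientAddGroup.mk' _) (m ⊗ₜ[ℤ] φ)) : (M →ₗ[Aᵐᵒᵖ] N) →+ U)) ν = φ (ν m)) ∧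
      Function.Bijective Φ := by
  obtain ⟨n, e, c, h⟩ := exists_finite_dual_basis Aᵐᵒᵖ M
  refine ⟨QuotientAddGroup.lift _ (tensorEval A B M N U) rel0_le_ker_tensorEval,
    fun m φ ν => rfl, Function.bijective_iff_has_inverse.2
      ⟨fun G => QuotientAddGroup.mk' _ (tensorOfHom e c G), fun q => ?_,
        tensorEval_tensorOfHom h⟩⟩
  obtain ⟨z, rfl⟩ := QuotientAddGroup.mk'_surjective _ q
  exact mk_tensorOfHom_tensorEval h z

end
end
end

section
/- Suppose the ring extension A|B admits a right D2 quasibase γ_j ∈ S, u_j ∈ T. Realize S ⊗_R E as the quotient of the tensor product of abelian groups S ⊗_ℤ E by the subgroup generated by {α(−)r ⊗ f − α ⊗ r·f(−) : α ∈ S, f ∈ E, r ∈ R}. Then the map S ⊗_R E → Hom(_B A⊗_B A, _B A) sending α⊗f to the map induced by a⊗a′ ↦ α(a)f(a′) is well defined and bijective; an inverse is given by F ↦ Σ_j γ_j ⊗ u_j¹F(u_j² ⊗ −). -/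
noncomputable section

open TensorProduct

variable (A : Type*) [Ring A] (B : Subring A)

/-- The `B`-balancing relations in `A ⊗_ℤ A`, realizing `A ⊗_B A` as a quotient of the
tensor product of abelian groups. -/
def relB : AddSubgroup (A ⊗[ℤ] A) :=
  AddSubgroup.closure {z | ∃ a a' b : A, b ∈ B ∧ z = (a * b) ⊗ₜ[ℤ] a' - a ⊗ₜ[ℤ] (b * a')}

/-- `A ⊗_B A`. -/
abbrev QB := (A ⊗[ℤ] A) ⧸ relB A B

/-- The canonical quotient map `A ⊗_ℤ A → A ⊗_B A`. -/
def mkB : A ⊗[ℤ] A →+ QB A B := QuotientAddGroup.mk' _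

theorem lmul_aux (c : A) :
    relB A B ≤ (relB A B).comap (LinearMap.rTensor A (LinearMap.mulLeft ℤ c)).toAddMonoidHom := by
  rw [relB, AddSubgroup.closure_le]
  rintro z ⟨a, a', b, hb, rfl⟩
  simp only [SetLike.mem_coe, AddSubgroup.mem_comap, LinearMap.toAddMonoidHom_coe, map_sub,
    LinearMap.rTensor_tmul, LinearMap.mulLeft_apply]
  rw [← mul_assoc]
  exact AddSubgroup.subset_closure ⟨c * a, a', b, hb, rfl⟩

theorem rmul_aux (c : A) :
    relB A B ≤ (relB A B).comap (LinearMap.lTensor A (LinearMap.mulRight ℤ c)).toAddMonoidHom := by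
  rw [relB, AddSubgroup.closure_le]
  rintro z ⟨a, a', b, hb, rfl⟩
  simp only [SetLike.mem_coe, AddSubgroup.mem_comap, LinearMap.toAddMonoidHom_coe, map_sub,
    LinearMap.lTensor_tmul, LinearMap.mulRight_apply]
  rw [mul_assoc]
  exact AddSubgroup.subset_closure ⟨a, a' * c, b, hb, rfl⟩

/-- The left `A`-action on `A ⊗_B A` through the left tensorand. -/
def lmulB (c : A) : QB A B →+ QB A B :=
  QuotientAddGroup.map _ _ (LinearMap.rTensor A (LinearMap.mulLeft ℤ c)).toAddMonoidHom
    (lmul_aux A B c)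

/-- The right `A`-action on `A ⊗_B A` through the right tensorand. -/
def rmulB (c : A) : QB A B →+ QB A B :=
  QuotientAddGroup.map _ _ (LinearMap.lTensor A (LinearMap.mulRight ℤ c)).toAddMonoidHom
    (rmul_aux A B c)

/-- `E = End(_B A)`: the left `B`-linear additive endomorphisms of `A`. -/
def Egrp : AddSubgroup (A →+ A) where
  carrier := {f | ∀ b ∈ B, ∀ a : A, f (b * a) = b * f a}
  add_mem' := by
    intro f g hf hg b hb a
    simp [hf b hb a, hg b hb a, mul_add]
  zero_mem' := by intro b hb a; simp
  neg_mem' := by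
    intro f hf b hb a
    simp [hf b hb a]

/-- `S = End(_B A_B)`: the `B`-`B`-bilinear additive endomorphisms of `A`. -/
def Sgrp : AddSubgroup (A →+ A) where
  carrier := {f | ∀ b ∈ B, ∀ a : A, f (b * a) = b * f a ∧ f (a * b) = f a * b}
  add_mem' := by
    intro f g hf hg b hb a
    exact ⟨by simp [(hf b hb a).1, (hg b hb a).1, mul_add],
      by simp [(hf b hb a).2, (hg b hb a).2, add_mul]⟩
  zero_mem' := by intro b hb a; simp
  neg_mem' := by
    intro f hf b hb a
    exact ⟨by simp [(hf b hb a).1], by simp [(hf b hb a).2]⟩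

/-- `Hom(_B A ⊗_B A, _B A)`: additive maps `A ⊗_B A → A` which are left `B`-linear for the
`B`-action through the left tensorand. -/
def HomBQ : AddSubgroup (QB A B →+ A) where
  carrier := {F | ∀ b ∈ B, ∀ q : QB A B, F (lmulB A B b q) = b * F q}
  add_mem' := by
    intro F G hF hG b hb q
    simp [hF b hb q, hG b hb q, mul_add]
  zero_mem' := by intro b hb q; simp
  neg_mem' := by
    intro F hF b hb q
    simp [hF b hb q]

/-- The `R`-balancing relations in `S ⊗_ℤ E`, where `R = C_A(B)` is the centralizer:
`α(−)r ⊗ f − α ⊗ r·f(−)`. -/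
def relSE : AddSubgroup (↥(Sgrp A B) ⊗[ℤ] ↥(Egrp A B)) :=
  AddSubgroup.closure
    {z | ∃ (α α' : ↥(Sgrp A B)) (f f' : ↥(Egrp A B)) (r : A),
      r ∈ Set.centralizer (B : Set A) ∧
      (∀ a : A, (α' : A →+ A) a = (α : A →+ A) a * r) ∧
      (∀ a : A, (f' : A →+ A) a = r * (f : A →+ A) a) ∧
      z = α' ⊗ₜ[ℤ] f - α ⊗ₜ[ℤ] f'}

section

variable {A B}

theorem mkB_surjective : Function.Surjective (mkB A B) :=
  QuotientAddGroup.mk'_surjective _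

theorem mkB_mul_tmul {b : A} (hb : b ∈ B) (a a' : A) :
    mkB A B ((a * b) ⊗ₜ[ℤ] a') = mkB A B (a ⊗ₜ[ℤ] (b * a')) := by
  rw [← sub_eq_zero, ← map_sub]
  exact (QuotientAddGroup.eq_zero_iff _).2 (AddSubgroup.subset_closure ⟨a, a', b, hb, rfl⟩)

@[simp]
theorem lmulB_mkB_tmul (c a a' : A) :
    lmulB A B c (mkB A B (a ⊗ₜ[ℤ] a')) = mkB A B ((c * a) ⊗ₜ[ℤ] a') :=
  rfl

@[simp]
theorem rmulB_mkB_tmul (c a a' : A) :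
    rmulB A B c (mkB A B (a ⊗ₜ[ℤ] a')) = mkB A B (a ⊗ₜ[ℤ] (a' * c)) :=
  rfl

theorem QB.induction_on {P : QB A B → Prop} (q : QB A B) (zero : P 0)
    (tmul : ∀ a a' : A, P (mkB A B (a ⊗ₜ[ℤ] a')))
    (add : ∀ x y, P x → P y → P (x + y)) : P q := by
  obtain ⟨z, rfl⟩ := mkB_surjective q
  induction z using TensorProduct.induction_on with
  | zero => rwa [map_zero]
  | tmul a a' => exact tmul a a'
  | add x y hx hy => rw [map_add]; exact add _ _ hx hy

theorem Sgrp_le_Egrp : Sgrp A B ≤ Egrp A B :=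
  fun _ hf b hb a ↦ (hf b hb a).1

/-- The additive map `A ⊗_B A → A`, `x ⊗ y ↦ x h(y)`, for a left `B`-linear `h`. -/
def mulApply (h : Egrp A B) : QB A B →+ A :=
  QuotientAddGroup.lift (relB A B)
    (LinearMap.mul' ℤ A ∘ₗ LinearMap.lTensor A (h : A →+ A).toIntLinearMap).toAddMonoidHom (by
      rw [relB, AddSubgroup.closure_le]
      rintro z ⟨a, a', b, hb, rfl⟩
      simp [h.2 b hb a', mul_assoc])

@[simp]
theorem mulApply_mkB_tmul (h : Egrp A B) (a a' : A) :
    mulApply h (mkB A B (a ⊗ₜ[ℤ] a')) = a * (h : A →+ A) a' :=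
  rfl

theorem mulApply_add (h k : Egrp A B) (q : QB A B) :
    mulApply (h + k) q = mulApply h q + mulApply k q := by
  induction q using QB.induction_on with
  | zero => simp
  | tmul a a' => simp [mul_add]
  | add x y hx hy => simp only [map_add, hx, hy]; abel

theorem mulApply_lmulB (h : Egrp A B) (c : A) (q : QB A B) :
    mulApply h (lmulB A B c q) = c * mulApply h q := by
  induction q using QB.induction_on with
  | zero => simp
  | tmul a a' => simp [mul_assoc]
  | add x y hx hy => simp only [map_add, hx, hy, mul_add]

theorem mulApply_rmulB {h k : Egrp A B} {c : A}
    (hk : ∀ a, (h : A →+ A) (a * c) = (k : A →+ A) a) (q : QB A B) :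
    mulApply h (rmulB A B c q) = mulApply k q := by
  induction q using QB.induction_on with
  | zero => simp
  | tmul a a' => simp [hk]
  | add x y hx hy => simp only [map_add, hx, hy]

theorem mulApply_rmulB_of_mul_right {h : Egrp A B} {c : A}
    (hc : ∀ a, (h : A →+ A) (a * c) = (h : A →+ A) a * c) (q : QB A B) :
    mulApply h (rmulB A B c q) = mulApply h q * c := by
  induction q using QB.induction_on with
  | zero => simp
  | tmul a a' => simp [hc, mul_assoc]
  | add x y hx hy => simp only [map_add, hx, hy, add_mul]

/-- A left `B`-linear map is determined by its values on the `u j` of a right quasibase. -/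
theorem apply_eq_sum_mulApply {n : ℕ} {γ : Fin n → Sgrp A B} {u : Fin n → QB A B}
    (hqb : ∀ a a' : A,
      mkB A B (a ⊗ₜ[ℤ] a') = ∑ j, lmulB A B (a * (γ j : A →+ A) a') (u j))
    (h : Egrp A B) (a : A) :
    (h : A →+ A) a = ∑ j, (γ j : A →+ A) a * mulApply h (u j) := by
  simpa [mulApply_lmulB] using congrArg (mulApply h) (hqb 1 a)

/-- The left `B`-linear map `F(− ⊗ a)`. -/
def slice (F : HomBQ A B) (a : A) : Egrp A B :=
  ⟨AddMonoidHom.mk' (fun y ↦ (F : QB A B →+ A) (mkB A B (y ⊗ₜ[ℤ] a)))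
    fun x y ↦ by simp [TensorProduct.add_tmul],
    fun b hb y ↦ F.2 b hb (mkB A B (y ⊗ₜ[ℤ] a))⟩

@[simp]
theorem slice_apply (F : HomBQ A B) (a y : A) :
    (slice F a : A →+ A) y = (F : QB A B →+ A) (mkB A B (y ⊗ₜ[ℤ] a)) :=
  rfl

theorem slice_add_right (F : HomBQ A B) (a a' : A) :
    slice F (a + a') = slice F a + slice F a' := by
  ext y
  simp [TensorProduct.tmul_add]

/-- The map `F ↦ q¹ F(q² ⊗ −)`, for a `B`-central element `q` of `A ⊗_B A`. -/
def contract (q : QB A B) (hq : ∀ b ∈ B, lmulB A B b q = rmulB A B b q) :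
    HomBQ A B →+ Egrp A B :=
  AddMonoidHom.mk' (fun F ↦
    ⟨AddMonoidHom.mk' (fun a ↦ mulApply (slice F a) q)
      fun a a' ↦ by rw [slice_add_right, mulApply_add],
      fun b hb a ↦ by
        change mulApply (slice F (b * a)) q = b * mulApply (slice F a) q
        rw [← mulApply_lmulB, hq b hb]
        exact (mulApply_rmulB (fun y ↦ by simp [mkB_mul_tmul hb]) q).symm⟩)
    fun F G ↦ by
      ext a
      exact mulApply_add (slice F a) (slice G a) q

@[simp]
theorem contract_apply (q : QB A B) (hq : ∀ b ∈ B, lmulB A B b q = rmulB A B b q)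
    (F : HomBQ A B) (a : A) :
    (contract q hq F : A →+ A) a = mulApply (slice F a) q :=
  rfl

/-- The map `a ⊗ a' ↦ α(a) f(a')`. -/
def mulPair (α : Sgrp A B) (f : Egrp A B) : HomBQ A B :=
  ⟨QuotientAddGroup.lift (relB A B)
    (LinearMap.mul' ℤ A ∘ₗ TensorProduct.map (α : A →+ A).toIntLinearMap
      (f : A →+ A).toIntLinearMap).toAddMonoidHom (by
      rw [relB, AddSubgroup.closure_le]
      rintro z ⟨a, a', b, hb, rfl⟩
      simp [f.2 b hb a', (α.2 b hb a).2, mul_assoc]),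
    fun b hb q ↦ by
      induction q using QB.induction_on with
      | zero => simp
      | tmul a a' =>
        change (α : A →+ A) (b * a) * (f : A →+ A) a'
          = b * ((α : A →+ A) a * (f : A →+ A) a')
        rw [(α.2 b hb a).1, mul_assoc]
      | add x y hx hy => simp only [map_add, hx, hy, mul_add]⟩

@[simp]
theorem mulPair_mkB_tmul (α : Sgrp A B) (f : Egrp A B) (a a' : A) :
    (mulPair α f : QB A B →+ A) (mkB A B (a ⊗ₜ[ℤ] a')) = (α : A →+ A) a * (f : A →+ A) a' :=
  rfl

theorem HomBQ.ext {F G : HomBQ A B}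
    (h : ∀ a a' : A, (F : QB A B →+ A) (mkB A B (a ⊗ₜ[ℤ] a'))
      = (G : QB A B →+ A) (mkB A B (a ⊗ₜ[ℤ] a'))) : F = G := by
  refine Subtype.ext (AddMonoidHom.ext fun q ↦ ?_)
  induction q using QB.induction_on with
  | zero => simp
  | tmul a a' => exact h a a'
  | add x y hx hy => simp only [map_add, hx, hy]

variable (A B) in
/-- `α ⊗ f ↦ (a ⊗ a' ↦ α(a) f(a'))` on the tensor product of abelian groups. -/
def mulPairHom : Sgrp A B ⊗[ℤ] Egrp A B →+ HomBQ A B :=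
  TensorProduct.liftAddHom
    (AddMonoidHom.mk' (fun α ↦ AddMonoidHom.mk' (mulPair α)
      fun f g ↦ HomBQ.ext fun a a' ↦ by simp [mul_add])
      fun α β ↦ AddMonoidHom.ext fun f ↦ HomBQ.ext fun a a' ↦ by simp [add_mul])
    fun r α f ↦ by rw [map_zsmul, map_zsmul, AddMonoidHom.zsmul_apply]

@[simp]
theorem mulPairHom_tmul (α : Sgrp A B) (f : Egrp A B) :
    mulPairHom A B (α ⊗ₜ[ℤ] f) = mulPair α f :=
  rfl

theorem relSE_le_ker_mulPairHom : relSE A B ≤ (mulPairHom A B).ker := by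
  rw [relSE, AddSubgroup.closure_le]
  rintro z ⟨α, α', f, f', r, -, hα, hf, rfl⟩
  rw [SetLike.mem_coe, AddMonoidHom.mem_ker, map_sub, sub_eq_zero]
  exact HomBQ.ext fun a a' ↦ by simp [hα, hf, mul_assoc]

variable (A B) in
/-- `S ⊗_R E → Hom(_B A ⊗_B A, _B A)`, `α ⊗ f ↦ (a ⊗ a' ↦ α(a) f(a'))`. -/
def tensorToHom : (Sgrp A B ⊗[ℤ] Egrp A B) ⧸ relSE A B →+ HomBQ A B :=
  QuotientAddGroup.lift (relSE A B) (mulPairHom A B) relSE_le_ker_mulPairHom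

@[simp]
theorem tensorToHom_mk' (z : Sgrp A B ⊗[ℤ] Egrp A B) :
    tensorToHom A B (QuotientAddGroup.mk' _ z) = mulPairHom A B z :=
  rfl

theorem mulPairHom_sum_contract {n : ℕ} {γ : Fin n → Sgrp A B} {u : Fin n → QB A B}
    (hu : ∀ j, ∀ b ∈ B, lmulB A B b (u j) = rmulB A B b (u j))
    (hqb : ∀ a a' : A,
      mkB A B (a ⊗ₜ[ℤ] a') = ∑ j, lmulB A B (a * (γ j : A →+ A) a') (u j))
    (F : HomBQ A B) :
    mulPairHom A B (∑ j, γ j ⊗ₜ[ℤ] contract (u j) (hu j) F) = F := by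
  refine HomBQ.ext fun a a' ↦ ?_
  simpa [AddSubgroup.val_finsetSum] using (apply_eq_sum_mulApply hqb (slice F a') a).symm

/-- Right multiplication of `α ∈ S` by an element of the centralizer of `B`. -/
def Sgrp.mulRight (α : Sgrp A B) (r : A) (hr : r ∈ Set.centralizer (B : Set A)) : Sgrp A B :=
  ⟨(AddMonoidHom.mulRight r).comp (α : A →+ A), fun b hb a ↦ by
    simp [(α.2 b hb a).1, (α.2 b hb a).2, mul_assoc, hr b hb]⟩

@[simp]
theorem Sgrp.mulRight_apply (α : Sgrp A B) (r : A) (hr : r ∈ Set.centralizer (B : Set A))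
    (a : A) : (Sgrp.mulRight α r hr : A →+ A) a = (α : A →+ A) a * r :=
  rfl

theorem mulApply_mem_centralizer (α : Sgrp A B) {q : QB A B}
    (hq : ∀ b ∈ B, lmulB A B b q = rmulB A B b q) :
    mulApply ⟨α, Sgrp_le_Egrp α.2⟩ q ∈ Set.centralizer (B : Set A) := fun b hb ↦ by
  rw [← mulApply_lmulB, hq b hb, mulApply_rmulB_of_mul_right fun a ↦ (α.2 b hb a).2]

theorem contract_mulPair (α : Sgrp A B) (f : Egrp A B) {q : QB A B}
    (hq : ∀ b ∈ B, lmulB A B b q = rmulB A B b q) (a : A) :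
    (contract q hq (mulPair α f) : A →+ A) a
      = mulApply ⟨α, Sgrp_le_Egrp α.2⟩ q * (f : A →+ A) a := by
  rw [contract_apply]
  clear hq
  induction q using QB.induction_on with
  | zero => simp
  | tmul x y => simp [mul_assoc]
  | add x y hx hy => simp only [map_add, hx, hy, add_mul]

theorem mk'_sum_contract_mulPairHom {n : ℕ} {γ : Fin n → Sgrp A B} {u : Fin n → QB A B}
    (hu : ∀ j, ∀ b ∈ B, lmulB A B b (u j) = rmulB A B b (u j))
    (hqb : ∀ a a' : A,
      mkB A B (a ⊗ₜ[ℤ] a') = ∑ j, lmulB A B (a * (γ j : A →+ A) a') (u j))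
    (z : Sgrp A B ⊗[ℤ] Egrp A B) :
    QuotientAddGroup.mk' (relSE A B)
      (∑ j, γ j ⊗ₜ[ℤ] contract (u j) (hu j) (mulPairHom A B z))
      = QuotientAddGroup.mk' (relSE A B) z := by
  induction z using TensorProduct.induction_on with
  | zero => simp
  | tmul α f =>
    have hα : α = ∑ j, Sgrp.mulRight (γ j) _ (mulApply_mem_centralizer α (hu j)) := by
      ext a
      simpa [AddSubgroup.val_finsetSum] using
        apply_eq_sum_mulApply hqb ⟨α, Sgrp_le_Egrp α.2⟩ a
    conv_rhs => rw [hα, TensorProduct.sum_tmul]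
    rw [map_sum, map_sum]
    refine Finset.sum_congr rfl fun j _ ↦ ?_
    rw [eq_comm, ← sub_eq_zero, ← map_sub]
    exact (QuotientAddGroup.eq_zero_iff _).2 <| AddSubgroup.subset_closure
      ⟨γ j, _, f, _, _, mulApply_mem_centralizer α (hu j), fun _ ↦ rfl,
        contract_mulPair α f (hu j), rfl⟩
  | add x y hx hy =>
    simp only [map_add, TensorProduct.tmul_add, Finset.sum_add_distrib] at hx hy ⊢
    rw [hx, hy]

end

/-- given a right D2 quasibase `γ_j ∈ S`, `u_j ∈ T`, the map
`S ⊗_R E → Hom(_B A ⊗_B A, _B A)`, `α ⊗ f ↦ (a ⊗ a' ↦ α(a) f(a'))` is well defined and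
bijective, with inverse `F ↦ ∑_j γ_j ⊗ u_j¹ F(u_j² ⊗ −)`. -/
theorem statement1 (n : ℕ) (γ : Fin n → ↥(Sgrp A B)) (u : Fin n → QB A B)
    (hu : ∀ j, ∀ b ∈ B, lmulB A B b (u j) = rmulB A B b (u j))
    (hqb : ∀ a a' : A,
      mkB A B (a ⊗ₜ[ℤ] a') = ∑ j, lmulB A B (a * (γ j : A →+ A) a') (u j)) :
    ∃ Φ : (↥(Sgrp A B) ⊗[ℤ] ↥(Egrp A B)) ⧸ relSE A B →+ ↥(HomBQ A B),
      (∀ (α : ↥(Sgrp A B)) (f : ↥(Egrp A B)) (a a' : A),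
        ((Φ ((QuotientAddGroup.mk' _) (α ⊗ₜ[ℤ] f)) : QB A B →+ A))
            (mkB A B (a ⊗ₜ[ℤ] a'))
          = (α : A →+ A) a * (f : A →+ A) a') ∧
      Function.Bijective Φ ∧
      (∀ (F : ↥(HomBQ A B)) (m : Fin n → ℕ) (p q : (j : Fin n) → Fin (m j) → A),
        (∀ j, mkB A B (∑ l, p j l ⊗ₜ[ℤ] q j l) = u j) →
        ∃ g : Fin n → ↥(Egrp A B),
          (∀ (j : Fin n) (a : A),
            (g j : A →+ A) a
              = ∑ l, p j l * (F : QB A B →+ A) (mkB A B (q j l ⊗ₜ[ℤ] a))) ∧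
          Φ ((QuotientAddGroup.mk' _) (∑ j, (γ j) ⊗ₜ[ℤ] (g j))) = F) := by
  refine ⟨tensorToHom A B, fun _ _ _ _ ↦ rfl, ⟨?_, fun F ↦
    ⟨_, (tensorToHom_mk' _).trans (mulPairHom_sum_contract hu hqb F)⟩⟩, fun F m p q hpq ↦
    ⟨fun j ↦ contract (u j) (hu j) F, fun j a ↦ ?_,
      (tensorToHom_mk' _).trans (mulPairHom_sum_contract hu hqb F)⟩⟩
  · intro x y hxy
    obtain ⟨x, rfl⟩ := QuotientAddGroup.mk'_surjective _ x
    obtain ⟨y, rfl⟩ := QuotientAddGroup.mk'_surjective _ y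
    rw [tensorToHom_mk', tensorToHom_mk'] at hxy
    rw [← mk'_sum_contract_mulPairHom hu hqb x, hxy, mk'_sum_contract_mulPairHom hu hqb y]
  · rw [contract_apply, ← hpq j]
    simp
end
end

section
/- Let k be a commutative ring, A a k-algebra and B a k-subalgebra of A which is Kanzaki separable, i.e. there is an element e = Σ e¹⊗e² ∈ B⊗_k B with Σ e¹e² = 1 = Σ e²e¹, Σ be¹⊗e² = Σ e¹⊗e²b and Σ e¹b⊗e² = Σ e¹⊗be² for all b ∈ B. Let T = (A⊗_B A)^B, a ring under the multiplication t∘t′ := t¹t′¹ ⊗ t′²t² with unit 1⊗1 (the opposite of the standard T-multiplication). Then the formula τ(t¹⊗t²) := Σ e¹t² ⊗ t¹e² gives a well-defined map τ : T → T which is an anti-automorphism of (T, ∘), i.e. τ(t∘t′) = τ(t′)∘τ(t), satisfies τ∘τ = id_T, and sends r⊗1 to 1⊗r for every r in the centralizer C_A(B). -/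
noncomputable section

open TensorProduct

variable (k : Type*) [CommRing k] (A : Type*) [Ring A] [Algebra k A] (B : Subalgebra k A)

/-- The `B`-balancing relations in `A ⊗_k A`, realizing `A ⊗_B A`. -/
def relk : Submodule k (A ⊗[k] A) :=
  Submodule.span k
    {z | ∃ (a a' : A) (b : B), z = (a * (b : A)) ⊗ₜ[k] a' - a ⊗ₜ[k] ((b : A) * a')}

/-- `A ⊗_B A`. -/
abbrev Qk := (A ⊗[k] A) ⧸ relk k A B

/-- The canonical quotient map `A ⊗_k A → A ⊗_B A`. -/
def mkk : A ⊗[k] A →ₗ[k] Qk k A B := (relk k A B).mkQ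

theorem lmulk_aux (c : A) :
    relk k A B ≤ (relk k A B).comap (LinearMap.rTensor A (LinearMap.mulLeft k c)) := by
  rw [relk, Submodule.span_le]
  rintro z ⟨a, a', b, rfl⟩
  simp only [SetLike.mem_coe, Submodule.mem_comap, map_sub, LinearMap.rTensor_tmul,
    LinearMap.mulLeft_apply]
  rw [← mul_assoc]
  exact Submodule.subset_span ⟨c * a, a', b, rfl⟩

theorem rmulk_aux (c : A) :
    relk k A B ≤ (relk k A B).comap (LinearMap.lTensor A (LinearMap.mulRight k c)) := by
  rw [relk, Submodule.span_le]
  rintro z ⟨a, a', b, rfl⟩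
  simp only [SetLike.mem_coe, Submodule.mem_comap, map_sub, LinearMap.lTensor_tmul,
    LinearMap.mulRight_apply]
  rw [mul_assoc]
  exact Submodule.subset_span ⟨a, a' * c, b, rfl⟩

/-- The left `A`-action on `A ⊗_B A` through the left tensorand. -/
def lmulk (c : A) : Qk k A B →ₗ[k] Qk k A B :=
  Submodule.mapQ _ _ (LinearMap.rTensor A (LinearMap.mulLeft k c)) (lmulk_aux k A B c)

/-- The right `A`-action on `A ⊗_B A` through the right tensorand. -/
def rmulk (c : A) : Qk k A B →ₗ[k] Qk k A B :=
  Submodule.mapQ _ _ (LinearMap.lTensor A (LinearMap.mulRight k c)) (rmulk_aux k A B c)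

/-- `T = (A ⊗_B A)^B`, the `B`-central elements of `A ⊗_B A`. -/
def Tcent : Set (Qk k A B) := {t | ∀ b : B, lmulk k A B (b : A) t = rmulk k A B (b : A) t}

/-- `A ⊗_k A ≅ A ⊗_k Aᵐᵒᵖ` as `k`-modules. -/
def opCongr : A ⊗[k] A ≃ₗ[k] A ⊗[k] Aᵐᵒᵖ :=
  TensorProduct.congr (LinearEquiv.refl k A) (MulOpposite.opLinearEquiv k)

/-- The multiplication `t ∘ t' = t¹t'¹ ⊗ t'²t²` (the opposite of the standard `T`-multiplication)
on representatives in `A ⊗_k A`. -/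
def cmul (x y : A ⊗[k] A) : A ⊗[k] A :=
  (opCongr k A).symm ((opCongr k A) x * (opCongr k A) y)

section

variable {k A B}

/-- The map `B ⊗ B → A ⊗ A` induced by the inclusion of `B` in `A`. -/
abbrev valTensor : B ⊗[k] B →ₗ[k] A ⊗[k] A :=
  TensorProduct.map B.val.toLinearMap B.val.toLinearMap

theorem cmul_tmul (a b c d : A) :
    cmul k A (a ⊗ₜ b) (c ⊗ₜ d) = (a * c) ⊗ₜ (d * b) := by
  simp [cmul, opCongr, ← MulOpposite.op_mul]

theorem cmul_one_tmul_one (x : A ⊗[k] A) : cmul k A x (1 ⊗ₜ 1) = x := by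
  have h : opCongr k A (1 ⊗ₜ 1) = 1 := rfl
  rw [cmul, h, mul_one, LinearEquiv.symm_apply_apply]

theorem cmul_assoc (x y z : A ⊗[k] A) :
    cmul k A (cmul k A x y) z = cmul k A x (cmul k A y z) := by
  simp [cmul, mul_assoc]

/-- `cmul` as a bilinear map. -/
def cmulBilin : A ⊗[k] A →ₗ[k] A ⊗[k] A →ₗ[k] A ⊗[k] A :=
  ((LinearMap.mul k (A ⊗[k] Aᵐᵒᵖ)).compl₁₂ (opCongr k A).toLinearMap
    (opCongr k A).toLinearMap).compr₂ (opCongr k A).symm.toLinearMap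

theorem cmulBilin_apply (x y : A ⊗[k] A) : cmulBilin x y = cmul k A x y := rfl

theorem cmul_add (x y z : A ⊗[k] A) : cmul k A x (y + z) = cmul k A x y + cmul k A x z :=
  (cmulBilin x).map_add y z

theorem add_cmul (x y z : A ⊗[k] A) : cmul k A (x + y) z = cmul k A x z + cmul k A y z :=
  cmulBilin.map_add₂ x y z

theorem zero_cmul (x : A ⊗[k] A) : cmul k A 0 x = 0 := cmulBilin.map_zero₂ x

theorem cmul_zero (x : A ⊗[k] A) : cmul k A x 0 = 0 := (cmulBilin x).map_zero

theorem comm_cmul (x y : A ⊗[k] A) :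
    TensorProduct.comm k A A (cmul k A x y) =
      cmul k A (TensorProduct.comm k A A y) (TensorProduct.comm k A A x) := by
  induction x with
  | zero => simp [zero_cmul, cmul_zero]
  | add x x' hx hx' => simp [add_cmul, cmul_add, hx, hx']
  | tmul a b =>
    induction y with
    | zero => simp [zero_cmul, cmul_zero]
    | add y y' hy hy' => simp [add_cmul, cmul_add, hy, hy']
    | tmul c d => simp [cmul_tmul]

theorem comm_valTensor (e : B ⊗[k] B) :
    TensorProduct.comm k A A (valTensor e) = valTensor (TensorProduct.comm k B B e) := by
  induction e with
  | zero => simp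
  | add x y hx hy => simp only [map_add, hx, hy]
  | tmul a b => simp

theorem mkk_eq_iff {x y : A ⊗[k] A} : mkk k A B x = mkk k A B y ↔ x - y ∈ relk k A B :=
  Submodule.Quotient.eq _

theorem mkk_mul_tmul (a a' : A) (b : B) :
    mkk k A B ((a * b) ⊗ₜ a') = mkk k A B (a ⊗ₜ (b * a')) :=
  mkk_eq_iff.2 (Submodule.subset_span ⟨a, a', b, rfl⟩)

theorem lmulk_mkk (c : A) (x : A ⊗[k] A) :
    lmulk k A B c (mkk k A B x) = mkk k A B (cmul k A (c ⊗ₜ 1) x) := by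
  induction x with
  | zero => simp [cmul_zero]
  | add x y hx hy => simp [cmul_add, hx, hy]
  | tmul a b => rw [cmul_tmul, mul_one]; rfl

theorem rmulk_mkk (c : A) (x : A ⊗[k] A) :
    rmulk k A B c (mkk k A B x) = mkk k A B (cmul k A (1 ⊗ₜ c) x) := by
  induction x with
  | zero => simp [cmul_zero]
  | add x y hx hy => simp [cmul_add, hx, hy]
  | tmul a b => rw [cmul_tmul, one_mul]; rfl

/-- A linear map on `A ⊗ A` which respects the balancing relations factors through `mkk`. -/
theorem map_eq_of_mkk_eq {M : Type*} [AddCommGroup M] [Module k M] (f : A ⊗[k] A →ₗ[k] M)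
    (hf : ∀ (a a' : A) (b : B), f ((a * b) ⊗ₜ a') = f (a ⊗ₜ (b * a')))
    {x y : A ⊗[k] A} (h : mkk k A B x = mkk k A B y) : f x = f y := by
  have hle : relk k A B ≤ LinearMap.ker f := by
    rw [relk, Submodule.span_le]
    rintro z ⟨a, a', b, rfl⟩
    simp [hf]
  simpa [sub_eq_zero] using hle (mkk_eq_iff.1 h)

theorem mkk_cmul_congr_right (x : A ⊗[k] A) {y y' : A ⊗[k] A}
    (h : mkk k A B y = mkk k A B y') :
    mkk k A B (cmul k A x y) = mkk k A B (cmul k A x y') := by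
  refine map_eq_of_mkk_eq (mkk k A B ∘ₗ cmulBilin x) (fun a a' b => ?_) h
  simp only [LinearMap.comp_apply, cmulBilin_apply]
  induction x with
  | zero => simp [zero_cmul]
  | add x x' hx hx' => simp only [add_cmul, map_add, hx, hx']
  | tmul c d => rw [cmul_tmul, cmul_tmul, ← mul_assoc, mkk_mul_tmul, mul_assoc]

theorem mkk_cmul_congr_left {x x' : A ⊗[k] A} (h : mkk k A B x = mkk k A B x')
    {y : A ⊗[k] A} (hy : mkk k A B y ∈ Tcent k A B) :
    mkk k A B (cmul k A x y) = mkk k A B (cmul k A x' y) := by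
  refine map_eq_of_mkk_eq (mkk k A B ∘ₗ cmulBilin.flip y) (fun a a' b => ?_) h
  have hb := hy b
  rw [lmulk_mkk, rmulk_mkk] at hb
  have := mkk_cmul_congr_right (a ⊗ₜ a') hb
  simp only [← cmul_assoc, cmul_tmul, mul_one, one_mul] at this
  exact this

theorem mkk_cmul_valTensor_left (e : B ⊗[k] B) {y : A ⊗[k] A}
    (hy : mkk k A B y ∈ Tcent k A B) :
    mkk k A B (cmul k A (valTensor e) y) =
      rmulk k A B (LinearMap.mul' k B e : B) (mkk k A B y) := by
  rw [rmulk_mkk]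
  induction e with
  | zero => simp [zero_cmul]
  | add e e' h h' =>
    simp only [map_add, add_cmul, h, h', Subalgebra.coe_add, TensorProduct.tmul_add]
  | tmul b c =>
    have hb := hy b
    rw [lmulk_mkk, rmulk_mkk] at hb
    have := mkk_cmul_congr_right (1 ⊗ₜ (c : A)) hb
    simp only [← cmul_assoc, cmul_tmul, mul_one, one_mul] at this
    exact this

theorem mkk_cmul_valTensor_one_tmul (e : B ⊗[k] B) {r : A}
    (hr : r ∈ Set.centralizer (B : Set A)) :
    mkk k A B (cmul k A (valTensor e) (1 ⊗ₜ r)) =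
      mkk k A B (1 ⊗ₜ ((LinearMap.mul' k B e : B) * r)) := by
  induction e with
  | zero => simp [zero_cmul]
  | add e e' h h' =>
    simp only [map_add, add_cmul, h, h', Subalgebra.coe_add, add_mul, TensorProduct.tmul_add]
  | tmul b c =>
    have hc : (c : A) * r = r * c := hr c c.2
    have := mkk_mul_tmul (k := k) 1 (r * c) b
    simpa [cmul_tmul, mul_assoc, hc] using this

theorem mkk_cmul_valTensor_right {e : B ⊗[k] B} (he : LinearMap.mul' k B e = 1)
    (x : A ⊗[k] A) :
    mkk k A B (cmul k A x (valTensor e)) = mkk k A B x := by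
  have h := mkk_cmul_valTensor_one_tmul (k := k) (A := A) (B := B) e (r := 1)
    (Set.one_mem_centralizer (S := (B : Set A)))
  rw [cmul_one_tmul_one, he, mul_one, Subalgebra.coe_one] at h
  rw [mkk_cmul_congr_right x h, cmul_one_tmul_one]

theorem cmul_valTensor_mul_tmul_one (e : B ⊗[k] B) (b : B) (y : A ⊗[k] A) :
    cmul k A (valTensor (e * (b ⊗ₜ 1))) y =
      cmul k A (valTensor e) (cmul k A ((b : A) ⊗ₜ 1) y) := by
  rw [← cmul_assoc]
  congr 1
  induction e with
  | zero => simp [zero_cmul]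
  | add e e' h h' => simp only [add_mul, map_add, add_cmul, h, h']
  | tmul c d => simp [cmul_tmul]

theorem cmul_valTensor_one_tmul_mul (e : B ⊗[k] B) (b : B) (y : A ⊗[k] A) :
    cmul k A (valTensor ((1 ⊗ₜ b) * e)) y =
      cmul k A (valTensor e) (cmul k A (1 ⊗ₜ (b : A)) y) := by
  rw [← cmul_assoc]
  congr 1
  induction e with
  | zero => simp [zero_cmul]
  | add e e' h h' => simp only [mul_add, map_add, add_cmul, h, h']
  | tmul c d => simp [cmul_tmul]

theorem mkk_cmul_valTensor_mem_Tcent {e : B ⊗[k] B}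
    (he : ∀ b : B, (b ⊗ₜ[k] (1 : B)) * e = e * ((1 : B) ⊗ₜ[k] b)) (y : A ⊗[k] A) :
    mkk k A B (cmul k A (valTensor e) y) ∈ Tcent k A B := by
  intro b
  have hl : cmul k A ((b : A) ⊗ₜ 1) (valTensor e) = valTensor ((b ⊗ₜ 1) * e) := by
    clear he
    induction e with
    | zero => simp [cmul_zero]
    | add e e' h h' => simp only [mul_add, map_add, cmul_add, h, h']
    | tmul c d => simp [cmul_tmul]
  have hr : cmul k A (1 ⊗ₜ (b : A)) (valTensor e) = valTensor (e * (1 ⊗ₜ b)) := by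
    clear he hl
    induction e with
    | zero => simp [cmul_zero]
    | add e e' h h' => simp only [add_mul, map_add, cmul_add, h, h']
    | tmul c d => simp [cmul_tmul]
  rw [lmulk_mkk, rmulk_mkk, ← cmul_assoc, ← cmul_assoc, hl, hr, he]

/-- The flip `x¹ ⊗ x² ↦ Σ e¹x² ⊗ x¹e²` twisted by `e`, with values in `A ⊗_B A`. -/
def twistedFlip (e : B ⊗[k] B) : A ⊗[k] A →ₗ[k] Qk k A B :=
  mkk k A B ∘ₗ cmulBilin (valTensor e) ∘ₗ (TensorProduct.comm k A A).toLinearMap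

theorem twistedFlip_apply (e : B ⊗[k] B) (x : A ⊗[k] A) :
    twistedFlip e x = mkk k A B (cmul k A (valTensor e) (TensorProduct.comm k A A x)) := rfl

theorem twistedFlip_congr {e : B ⊗[k] B}
    (he : ∀ b : B, e * (b ⊗ₜ[k] (1 : B)) = ((1 : B) ⊗ₜ[k] b) * e) {x y : A ⊗[k] A}
    (h : mkk k A B x = mkk k A B y) : twistedFlip e x = twistedFlip e y := by
  refine map_eq_of_mkk_eq (twistedFlip e) (fun a a' b => ?_) h
  have hl := cmul_valTensor_mul_tmul_one e b (a' ⊗ₜ a)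
  rw [he, cmul_valTensor_one_tmul_mul, cmul_tmul, cmul_tmul, one_mul, mul_one] at hl
  simp only [twistedFlip_apply, TensorProduct.comm_tmul, hl]

end

/-- if `B` is a Kanzaki separable `k`-subalgebra of `A` with symmetric separability
element `e`, then `τ(t¹ ⊗ t²) = Σ e¹t² ⊗ t¹e²` is a well-defined map `T → T` which is an
anti-automorphism of `(T, ∘)` of order two, sending `r ⊗ 1` to `1 ⊗ r` for `r ∈ C_A(B)`. -/
theorem statement5 (e : B ⊗[k] B)
    (he1 : LinearMap.mul' k B e = 1)
    (he1' : LinearMap.mul' k B ((TensorProduct.comm k B B) e) = 1)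
    (he2 : ∀ b : B, (b ⊗ₜ[k] (1 : B)) * e = e * ((1 : B) ⊗ₜ[k] b))
    (he3 : ∀ b : B, e * (b ⊗ₜ[k] (1 : B)) = ((1 : B) ⊗ₜ[k] b) * e) :
    ∃ τ : {t : Qk k A B // t ∈ Tcent k A B} → {t : Qk k A B // t ∈ Tcent k A B},
      -- τ is given by the formula `τ(t¹ ⊗ t²) = Σ e¹t² ⊗ t¹e²` on any representatives
      (∀ (t : {t : Qk k A B // t ∈ Tcent k A B}) (p : ℕ) (x1 x2 : Fin p → A)
          (m : ℕ) (e1 e2 : Fin m → B),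
        mkk k A B (∑ j, x1 j ⊗ₜ[k] x2 j) = (t : Qk k A B) →
        (∑ i, e1 i ⊗ₜ[k] e2 i) = e →
        (τ t : Qk k A B)
          = ∑ j, ∑ i, mkk k A B ((((e1 i : A)) * x2 j) ⊗ₜ[k] (x1 j * ((e2 i : A))))) ∧
      -- τ is an anti-homomorphism for the multiplication `∘` on `T`
      (∀ (t t' : {t : Qk k A B // t ∈ Tcent k A B}) (x y u v : A ⊗[k] A),
        mkk k A B x = (t : Qk k A B) → mkk k A B y = (t' : Qk k A B) →
        mkk k A B u = (τ t' : Qk k A B) → mkk k A B v = (τ t : Qk k A B) →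
        ∀ s : {t : Qk k A B // t ∈ Tcent k A B},
          (s : Qk k A B) = mkk k A B (cmul k A x y) →
          (τ s : Qk k A B) = mkk k A B (cmul k A u v)) ∧
      -- τ ∘ τ = id
      (∀ t : {t : Qk k A B // t ∈ Tcent k A B}, τ (τ t) = t) ∧
      -- τ (r ⊗ 1) = 1 ⊗ r for r in the centralizer of B in A
      (∀ r : A, r ∈ Set.centralizer (B : Set A) →
        ∀ t : {t : Qk k A B // t ∈ Tcent k A B},
          (t : Qk k A B) = mkk k A B (r ⊗ₜ[k] 1) →
          (τ t : Qk k A B) = mkk k A B (1 ⊗ₜ[k] r)) := by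
  have hsurj : ∀ t : Qk k A B, ∃ x, mkk k A B x = t := Submodule.mkQ_surjective _
  choose rep hrep using hsurj
  let τ : {t : Qk k A B // t ∈ Tcent k A B} → {t : Qk k A B // t ∈ Tcent k A B} :=
    fun t => ⟨twistedFlip e (rep t), mkk_cmul_valTensor_mem_Tcent he2 _⟩
  have hτ : ∀ (t : {t : Qk k A B // t ∈ Tcent k A B}) (x : A ⊗[k] A),
      mkk k A B x = t → (τ t : Qk k A B) = twistedFlip e x := fun t x h =>
    twistedFlip_congr he3 ((hrep t).trans h.symm)
  have hone : rmulk k A B ((1 : B) : A) = LinearMap.id := by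
    refine LinearMap.ext fun t => ?_
    rw [← hrep t, rmulk_mkk, Subalgebra.coe_one]
    exact congrArg _ (congrArg (opCongr k A).symm (one_mul _)) |>.trans (by simp)
  refine ⟨τ, ?_, ?_, ?_, ?_⟩
  · rintro t p x1 x2 m e1 e2 hx rfl
    rw [hτ t _ hx]
    simp only [map_sum, twistedFlip_apply, TensorProduct.comm_tmul]
    refine Finset.sum_congr rfl fun j _ => ?_
    simp only [← cmulBilin_apply, LinearMap.sum_apply, map_sum]
    simp [cmulBilin_apply, cmul_tmul]
  · intro t t' x y u v hx hy hu hv s hs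
    have hy' : mkk k A B (cmul k A (valTensor (TensorProduct.comm k B B e)) y) =
        mkk k A B y := by
      rw [mkk_cmul_valTensor_left _ (hy ▸ t'.2), he1', hone, LinearMap.id_apply]
    rw [hτ s _ hs.symm, ← twistedFlip_congr he3 (mkk_cmul_congr_right x hy'),
      mkk_cmul_congr_left (hu.trans ((hτ t' y hy).trans (twistedFlip_apply e y))) (hv ▸ (τ t).2),
      mkk_cmul_congr_right _ (hv.trans ((hτ t x hx).trans (twistedFlip_apply e x))), twistedFlip_apply, comm_cmul, comm_cmul,
      ← comm_valTensor, TensorProduct.comm_comm]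
    simp only [cmul_assoc]
  · intro t
    refine Subtype.ext ?_
    rw [hτ (τ t) _ ((hτ t _ (hrep t)).trans (twistedFlip_apply e _)).symm, twistedFlip_apply, comm_cmul, comm_valTensor,
      TensorProduct.comm_comm, mkk_cmul_congr_right _ (mkk_cmul_valTensor_right he1' _),
      mkk_cmul_valTensor_left _ ((hrep t).symm ▸ t.2), he1, hone, LinearMap.id_apply, hrep]
  · intro r hr t ht
    rw [hτ t _ ht.symm, twistedFlip_apply, TensorProduct.comm_tmul,
      mkk_cmul_valTensor_one_tmul e hr, he1, Subalgebra.coe_one, one_mul]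
end
end

section
/- Let K be a normal Hopf subalgebra of a finite-dimensional Hopf algebra H over a field k. Then the subspace HK⁺ equals K⁺H and is a two-sided ideal and a coideal of H; let π : H → H̄ := H/HK⁺ denote the quotient map. The map β̄ : H⊗_K H → H⊗H̄ induced by x⊗y ↦ x y₍₁₎ ⊗ π(y₍₂₎) is well defined and bijective, with inverse induced by x ⊗ π(y) ↦ x τ(y₍₁₎) ⊗ y₍₂₎. -/
noncomputable section

open TensorProduct

universe u v

variable (k : Type u) [Field k]

/-- The `K`-balancing relations in `H ⊗_k H`, realizing `H ⊗_K H`. -/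
def relK (H : Type v) [Ring H] [Algebra k H] (K : Subalgebra k H) : Submodule k (H ⊗[k] H) :=
  Submodule.span k {z | ∃ (x y : H) (b : H), b ∈ K ∧ z = (x * b) ⊗ₜ[k] y - x ⊗ₜ[k] (b * y)}

/-- `a ↦ Σ τ(a₍₁₎) x a₍₂₎` as a map on `H ⊗ H` (to be applied to `Δa`). -/
def adL (H : Type v) [Ring H] [HopfAlgebra k H] (x : H) : H ⊗[k] H →ₗ[k] H :=
  LinearMap.mul' k H ∘ₗ
    TensorProduct.map (LinearMap.mulRight k x ∘ₗ HopfAlgebra.antipode (R := k)) LinearMap.id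

/-- `a ↦ Σ a₍₁₎ x τ(a₍₂₎)` as a map on `H ⊗ H` (to be applied to `Δa`). -/
def adR (H : Type v) [Ring H] [HopfAlgebra k H] (x : H) : H ⊗[k] H →ₗ[k] H :=
  LinearMap.mul' k H ∘ₗ
    TensorProduct.map LinearMap.id (LinearMap.mulLeft k x ∘ₗ HopfAlgebra.antipode (R := k))

/-- The subspace `HK⁺` of `H`, where `K⁺ = K ∩ ker ε`. -/
def HKp (H : Type v) [Ring H] [HopfAlgebra k H] (K : Subalgebra k H) : Submodule k H :=
  Submodule.span k
    {z | ∃ (h x : H), x ∈ K ∧ Coalgebra.counit (R := k) x = 0 ∧ z = h * x}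

/-- The subspace `K⁺H` of `H`. -/
def KpH (H : Type v) [Ring H] [HopfAlgebra k H] (K : Subalgebra k H) : Submodule k H :=
  Submodule.span k
    {z | ∃ (h x : H), x ∈ K ∧ Coalgebra.counit (R := k) x = 0 ∧ z = x * h}

section

open Coalgebra HopfAlgebra

variable {k} {H : Type v} [Ring H] [HopfAlgebra k H]

theorem sub_algebraMap_counit_mem {K : Subalgebra k H} {b : H} (hb : b ∈ K) :
    b - algebraMap k H (counit (R := k) b) ∈ K ∧
      counit (R := k) (b - algebraMap k H (counit (R := k) b)) = 0 :=
  ⟨K.sub_mem hb (K.algebraMap_mem _), by simp⟩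

theorem mul_mem_HKp {K : Subalgebra k H} {x : H} (hx : x ∈ K) (hε : counit (R := k) x = 0)
    (h : H) : h * x ∈ HKp k H K :=
  Submodule.subset_span ⟨h, x, hx, hε, rfl⟩

theorem mul_mem_KpH {K : Subalgebra k H} {x : H} (hx : x ∈ K) (hε : counit (R := k) x = 0)
    (h : H) : x * h ∈ KpH k H K :=
  Submodule.subset_span ⟨h, x, hx, hε, rfl⟩

theorem adR_tmul (x a b : H) : adR k H x (a ⊗ₜ b) = a * (x * antipode k b) := by
  simp [adR]

theorem adL_tmul (x a b : H) : adL k H x (a ⊗ₜ b) = antipode k a * x * b := by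
  simp [adL]

theorem counit_adR (x : H) (t : H ⊗[k] H) (hx : counit (R := k) x = 0) :
    counit (R := k) (adR k H x t) = 0 := by
  induction t with
  | zero => simp
  | add s t hs ht => simp [hs, ht]
  | tmul a b => simp [adR_tmul, hx]

theorem counit_adL (x : H) (t : H ⊗[k] H) (hx : counit (R := k) x = 0) :
    counit (R := k) (adL k H x t) = 0 := by
  induction t with
  | zero => simp
  | add s t hs ht => simp [hs, ht]
  | tmul a b => simp [adL_tmul, hx]

/-- `h x = Σ (h₍₁₎ x τ(h₍₂₎)) h₍₃₎`. -/
theorem mul'_rTensor_adR_comul (x h : H) :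
    LinearMap.mul' k H ((adR k H x ∘ₗ comul).rTensor H (comul (R := k) h)) = h * x := by
  have key : ∀ t : H ⊗[k] (H ⊗[k] H),
      LinearMap.mul' k H ((adR k H x).rTensor H ((TensorProduct.assoc k H H H).symm t)) =
        LinearMap.mul' k H (TensorProduct.map (LinearMap.mulRight k x)
          (LinearMap.mul' k H ∘ₗ (antipode k).rTensor H) t) := by
    intro t
    refine LinearMap.congr_fun (f := LinearMap.mul' k H ∘ₗ (adR k H x).rTensor H ∘ₗ
      (TensorProduct.assoc k H H H).symm.toLinearMap) (g := LinearMap.mul' k H ∘ₗ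
      TensorProduct.map (LinearMap.mulRight k x)
          (LinearMap.mul' k H ∘ₗ (antipode k).rTensor H)) ?_ t
    ext a b c
    simp [adR_tmul, mul_assoc]
  rw [LinearMap.rTensor_comp_apply, ← coassoc_symm_apply, key, LinearMap.lTensor,
    ← LinearMap.comp_apply (TensorProduct.map _ _), ← TensorProduct.map_comp,
    LinearMap.comp_assoc, mul_antipode_rTensor_comul, ← LinearMap.comp_id (LinearMap.mulRight k x),
    TensorProduct.map_comp, LinearMap.comp_apply, ← LinearMap.lTensor,
    lTensor_counit_comul]
  simp

/-- `x h = Σ h₍₁₎ (τ(h₍₂₎) x h₍₃₎)`. -/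
theorem mul'_lTensor_adL_comul (x h : H) :
    LinearMap.mul' k H ((adL k H x ∘ₗ comul).lTensor H (comul (R := k) h)) = x * h := by
  have key : ∀ t : (H ⊗[k] H) ⊗[k] H,
      LinearMap.mul' k H ((adL k H x).lTensor H (TensorProduct.assoc k H H H t)) =
        LinearMap.mul' k H (TensorProduct.map (LinearMap.mul' k H ∘ₗ (antipode k).lTensor H)
          (LinearMap.mulLeft k x) t) := by
    intro t
    refine LinearMap.congr_fun (f := LinearMap.mul' k H ∘ₗ (adL k H x).lTensor H ∘ₗ
      (TensorProduct.assoc k H H H).toLinearMap) (g := LinearMap.mul' k H ∘ₗ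
      TensorProduct.map (LinearMap.mul' k H ∘ₗ (antipode k).lTensor H)
          (LinearMap.mulLeft k x)) ?_ t
    ext a b c
    simp [adL_tmul, mul_assoc]
  rw [LinearMap.lTensor_comp_apply, ← coassoc_apply, key, LinearMap.rTensor,
    ← LinearMap.comp_apply (TensorProduct.map _ _), ← TensorProduct.map_comp,
    LinearMap.comp_assoc, mul_antipode_lTensor_comul, TensorProduct.map_comp,
    LinearMap.comp_apply, ← LinearMap.rTensor, rTensor_counit_comul]
  simp

theorem HKp_le_KpH {K : Subalgebra k H}
    (h_ad : ∀ x ∈ K, ∀ a : H, adR k H x (comul (R := k) a) ∈ K) : HKp k H K ≤ KpH k H K := by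
  refine Submodule.span_le.2 ?_
  rintro _ ⟨h, x, hx, hε, rfl⟩
  rw [← mul'_rTensor_adR_comul (k := k)]
  induction comul (R := k) h with
  | zero => simp
  | add s t hs ht => simpa only [map_add, SetLike.mem_coe] using add_mem hs ht
  | tmul a b => exact mul_mem_KpH (h_ad x hx a) (counit_adR x _ hε) b

theorem KpH_le_HKp {K : Subalgebra k H}
    (h_ad : ∀ x ∈ K, ∀ a : H, adL k H x (comul (R := k) a) ∈ K) : KpH k H K ≤ HKp k H K := by
  refine Submodule.span_le.2 ?_
  rintro _ ⟨h, x, hx, hε, rfl⟩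
  rw [← mul'_lTensor_adL_comul (k := k)]
  induction comul (R := k) h with
  | zero => simp
  | add s t hs ht => simpa only [map_add, SetLike.mem_coe] using add_mem hs ht
  | tmul a b => exact mul_mem_HKp (h_ad x hx b) (counit_adL x _ hε) a

theorem HKp_mul_mem_left {K : Subalgebra k H} {a : H} (ha : a ∈ HKp k H K) (h : H) :
    h * a ∈ HKp k H K := by
  induction ha using Submodule.span_induction with
  | mem _ hz =>
    obtain ⟨g, x, hx, hε, rfl⟩ := hz
    rw [← mul_assoc]
    exact mul_mem_HKp hx hε _
  | zero => simp
  | add a b _ _ ha hb => rw [mul_add]; exact add_mem ha hb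
  | smul c a _ ha => rw [mul_smul_comm]; exact Submodule.smul_mem _ c ha

theorem KpH_mul_mem_right {K : Subalgebra k H} {a : H} (ha : a ∈ KpH k H K) (h : H) :
    a * h ∈ KpH k H K := by
  induction ha using Submodule.span_induction with
  | mem _ hz =>
    obtain ⟨g, x, hx, hε, rfl⟩ := hz
    rw [mul_assoc]
    exact mul_mem_KpH hx hε _
  | zero => simp
  | add a b _ _ ha hb => rw [add_mul]; exact add_mem ha hb
  | smul c a _ ha => rw [smul_mul_assoc]; exact Submodule.smul_mem _ c ha

theorem counit_eq_zero_of_mem_HKp {K : Subalgebra k H} {a : H} (ha : a ∈ HKp k H K) :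
    counit (R := k) a = 0 := by
  have : HKp k H K ≤ LinearMap.ker (counit (R := k) (A := H)) := by
    refine Submodule.span_le.2 ?_
    rintro _ ⟨h, x, -, hε, rfl⟩
    simp [hε]
  exact this ha

theorem comul_mem_of_mem_HKp {K : Subalgebra k H}
    (hΔ : ∀ x ∈ K, comul (R := k) x ∈
      LinearMap.range (TensorProduct.map K.val.toLinearMap K.val.toLinearMap))
    {a : H} (ha : a ∈ HKp k H K) : comul (R := k) a ∈
      LinearMap.range (TensorProduct.map (HKp k H K).subtype (LinearMap.id (M := H))) ⊔
      LinearMap.range (TensorProduct.map (LinearMap.id (M := H)) (HKp k H K).subtype) := by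
  set N := LinearMap.range (TensorProduct.map (HKp k H K).subtype (LinearMap.id (M := H))) ⊔
      LinearMap.range (TensorProduct.map (LinearMap.id (M := H)) (HKp k H K).subtype)
  have left_mem : ∀ {u : H} (_ : u ∈ HKp k H K) (v : H), u ⊗ₜ[k] v ∈ N := fun hu v ↦
    Submodule.mem_sup_left ⟨(⟨_, hu⟩ : HKp k H K) ⊗ₜ v, rfl⟩
  have right_mem : ∀ (u : H) {v : H} (_ : v ∈ HKp k H K), u ⊗ₜ[k] v ∈ N := fun u _ hv ↦
    Submodule.mem_sup_right ⟨u ⊗ₜ (⟨_, hv⟩ : HKp k H K), rfl⟩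
  have reduce : ∀ (t : H ⊗[k] H) (s : K ⊗[k] K),
      t * (TensorProduct.map K.val.toLinearMap K.val.toLinearMap s -
        (Algebra.linearMap k H ∘ₗ counit).rTensor H
          (TensorProduct.map K.val.toLinearMap K.val.toLinearMap s)) ∈ N := by
    intro t s
    induction s with
    | zero => simp
    | add s s' hs hs' =>
      convert add_mem hs hs' using 1
      simp only [map_add]
      noncomm_ring
    | tmul a b =>
      induction t with
      | zero => simp
      | add t t' ht ht' => rw [add_mul]; exact add_mem ht ht'
      | tmul c d =>
        obtain ⟨h1, h2⟩ := sub_algebraMap_counit_mem a.2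
        simpa [← TensorProduct.sub_tmul, ← mul_sub] using
          left_mem (mul_mem_HKp h1 h2 c) (d * b)
  have mul_mem : ∀ (t : H ⊗[k] H) {x : H} (_ : x ∈ K) (_ : counit (R := k) x = 0),
      t * ((1 : H) ⊗ₜ x) ∈ N := by
    intro t x hx hε
    induction t with
    | zero => simp
    | add t t' ht ht' => rw [add_mul]; exact add_mem ht ht'
    | tmul c d => simpa using right_mem c (mul_mem_HKp hx hε d)
  induction ha using Submodule.span_induction with
  | mem _ hz =>
    obtain ⟨h, x, hx, hε, rfl⟩ := hz
    obtain ⟨s, hs⟩ := hΔ x hx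
    have := reduce (comul (R := k) h) s
    rw [hs, LinearMap.rTensor_comp_apply, rTensor_counit_comul, mul_sub] at this
    rw [Bialgebra.comul_mul]
    simpa using add_mem this (mul_mem (comul (R := k) h) hx hε)
  | zero => simp
  | add a b _ _ ha hb => rw [map_add]; exact add_mem ha hb
  | smul c a _ ha => rw [map_smul]; exact Submodule.smul_mem _ c ha

/-- The map `x ⊗ y ↦ Σ x q(y₍₁₎) ⊗ y₍₂₎` on `H ⊗ H`. -/
def twistedCan (q : H →ₗ[k] H) : H ⊗[k] H →ₗ[k] H ⊗[k] H :=
  TensorProduct.lift ((LinearMap.mul k (H ⊗[k] H)).compl₁₂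
    ((TensorProduct.mk k H H).flip 1) (q.rTensor H ∘ₗ comul))

theorem twistedCan_tmul (q : H →ₗ[k] H) (x y : H) :
    twistedCan q (x ⊗ₜ y) = (x ⊗ₜ[k] (1 : H)) * q.rTensor H (comul y) := rfl

theorem twistedCan_tmul_one_mul (p q : H →ₗ[k] H) (x : H) (t : H ⊗[k] H) :
    twistedCan q ((x ⊗ₜ[k] (1 : H)) * p.rTensor H t) =
      (x ⊗ₜ[k] (1 : H)) * (LinearMap.mul' k H ∘ₗ TensorProduct.map p q).rTensor H
        ((TensorProduct.assoc k H H H).symm (comul.lTensor H t)) := by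
  induction t with
  | zero => simp
  | add s t hs ht => simp only [map_add, mul_add, hs, ht]
  | tmul a b =>
    simp only [LinearMap.rTensor_tmul, Algebra.TensorProduct.tmul_mul_tmul, one_mul,
      twistedCan_tmul, LinearMap.lTensor_tmul]
    induction comul (R := k) b with
    | zero => simp
    | add s t hs ht => simp only [map_add, mul_add, TensorProduct.tmul_add, hs, ht]
    | tmul c d => simp [mul_assoc]

theorem twistedCan_twistedCan {p q : H →ₗ[k] H}
    (hpq : LinearMap.mul' k H ∘ₗ TensorProduct.map p q ∘ₗ comul = Algebra.linearMap k H ∘ₗ counit)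
    (t : H ⊗[k] H) : twistedCan q (twistedCan p t) = t := by
  induction t with
  | zero => simp
  | add s t hs ht => simp only [map_add, hs, ht]
  | tmul x y =>
    rw [twistedCan_tmul, twistedCan_tmul_one_mul, coassoc_symm_apply,
      ← LinearMap.rTensor_comp_apply, LinearMap.comp_assoc, hpq, LinearMap.rTensor_comp_apply,
      rTensor_counit_comul]
    simp

/-- `π(Σ x b₍₁₎ y₍₁₎ ⊗ b₍₂₎ y₍₂₎) = π(Σ x b y₍₁₎ ⊗ y₍₂₎)`, the balancing of the Galois map. -/
theorem relK_le_ker {K : Subalgebra k H} (hle : KpH k H K ≤ HKp k H K)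
    (hΔ : ∀ x ∈ K, comul (R := k) x ∈
      LinearMap.range (TensorProduct.map K.val.toLinearMap K.val.toLinearMap)) :
    relK k H K ≤ LinearMap.ker ((HKp k H K).mkQ.lTensor H ∘ₗ twistedCan LinearMap.id) := by
  have reduce : ∀ (s : K ⊗[k] K) (v : H ⊗[k] H),
      (HKp k H K).mkQ.lTensor H
        (TensorProduct.map K.val.toLinearMap K.val.toLinearMap s * v) =
      (HKp k H K).mkQ.lTensor H ((Algebra.linearMap k H ∘ₗ counit).lTensor H
        (TensorProduct.map K.val.toLinearMap K.val.toLinearMap s) * v) := by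
    intro s v
    induction s with
    | zero => simp
    | add s s' hs hs' => simp only [map_add, add_mul, hs, hs']
    | tmul a b =>
      induction v with
      | zero => simp
      | add t t' ht ht' => simp only [map_add, mul_add, ht, ht']
      | tmul c d =>
        obtain ⟨h1, h2⟩ := sub_algebraMap_counit_mem b.2
        have := hle (mul_mem_KpH h1 h2 d)
        rw [sub_mul, ← Submodule.Quotient.eq] at this
        simp [this]
  refine Submodule.span_le.2 ?_
  rintro _ ⟨x, y, b, hb, rfl⟩
  obtain ⟨s, hs⟩ := hΔ b hb
  have h_mul : ∀ t : H ⊗[k] H, (HKp k H K).mkQ.lTensor H ((x ⊗ₜ[k] (1 : H)) * t) =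
      TensorProduct.map (LinearMap.mulLeft k x) LinearMap.id ((HKp k H K).mkQ.lTensor H t) := by
    intro t
    induction t with
    | zero => simp
    | add s t hs ht => simp only [map_add, mul_add, hs, ht]
    | tmul a b => simp
  have h_red := reduce s (comul (R := k) y)
  rw [hs, LinearMap.lTensor_comp_apply, lTensor_counit_comul] at h_red
  have hx : (x * b) ⊗ₜ[k] (1 : H) = (x ⊗ₜ[k] (1 : H)) * (b ⊗ₜ[k] (1 : H)) := by simp
  simp only [SetLike.mem_coe, LinearMap.mem_ker, LinearMap.comp_apply, map_sub, twistedCan_tmul,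
    LinearMap.rTensor_id, LinearMap.id_apply, Bialgebra.comul_mul, hx, mul_assoc, h_mul, h_red]
  simp

theorem mkQ_twistedCan_antipode_mul {K : Subalgebra k H}
    (hΔ : ∀ x ∈ K, comul (R := k) x ∈
      LinearMap.range (TensorProduct.map K.val.toLinearMap K.val.toLinearMap))
    (x y : H) {b : H} (hb : b ∈ K) :
    (relK k H K).mkQ (twistedCan (antipode k) (x ⊗ₜ (b * y))) =
      counit (R := k) b • (relK k H K).mkQ (twistedCan (antipode k) (x ⊗ₜ y)) := by
  have balance : ∀ (s : K ⊗[k] K) (c d : H),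
      (relK k H K).mkQ ((x ⊗ₜ[k] (1 : H)) * (antipode k).rTensor H
        (TensorProduct.map K.val.toLinearMap K.val.toLinearMap s * c ⊗ₜ d)) =
      (relK k H K).mkQ ((x * antipode k c * LinearMap.mul' k H ((antipode k).rTensor H
        (TensorProduct.map K.val.toLinearMap K.val.toLinearMap s))) ⊗ₜ d) := by
    intro s c d
    induction s with
    | zero => simp
    | add s s' hs hs' => simp only [map_add, add_mul, mul_add, TensorProduct.add_tmul, hs, hs']
    | tmul a b =>
      rw [← sub_eq_zero, ← map_sub, ← neg_eq_zero, ← map_neg, neg_sub, Submodule.mkQ_apply,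
        Submodule.Quotient.mk_eq_zero]
      refine Submodule.subset_span ⟨x * antipode k c * antipode k (a : H), d, b, b.2, ?_⟩
      simp [antipode_mul_antidistrib, mul_assoc]
  obtain ⟨s, hs⟩ := hΔ b hb
  rw [twistedCan_tmul, twistedCan_tmul, Bialgebra.comul_mul]
  induction comul (R := k) y with
  | zero => simp
  | add t t' ht ht' => simp only [map_add, mul_add, smul_add, ht, ht']
  | tmul c d =>
    have h := balance s c d
    rw [hs, mul_antipode_rTensor_comul_apply, ← Algebra.commutes, ← Algebra.smul_def,
      ← TensorProduct.smul_tmul', map_smul] at h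
    simpa using h

theorem HKp_le_ker_mkQ_twistedCan {K : Subalgebra k H} (hle : HKp k H K ≤ KpH k H K)
    (hΔ : ∀ x ∈ K, comul (R := k) x ∈
      LinearMap.range (TensorProduct.map K.val.toLinearMap K.val.toLinearMap)) :
    HKp k H K ≤ LinearMap.ker ((TensorProduct.mk k H H).compr₂
      ((relK k H K).mkQ ∘ₗ twistedCan (antipode k))).flip := by
  refine hle.trans (Submodule.span_le.2 ?_)
  rintro _ ⟨h, b, hb, hε, rfl⟩
  ext x
  simpa [hε] using mkQ_twistedCan_antipode_mul hΔ x h hb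

end

/-- for a normal Hopf subalgebra `K` of a finite-dimensional Hopf algebra `H`
over a field `k`, `HK⁺ = K⁺H` is a two-sided ideal and a coideal; with `π : H → H̄ = H/HK⁺`,
the map `β̄ : H ⊗_K H → H ⊗ H̄` induced by `x ⊗ y ↦ x y₍₁₎ ⊗ π(y₍₂₎)` is well defined and
bijective with inverse induced by `x ⊗ π(y) ↦ x τ(y₍₁₎) ⊗ y₍₂₎`. -/
theorem statement8 (H : Type v) [Ring H] [HopfAlgebra k H] [FiniteDimensional k H]
    (K : Subalgebra k H)
    (hΔ : ∀ x ∈ K, Coalgebra.comul (R := k) x ∈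
      LinearMap.range (TensorProduct.map K.val.toLinearMap K.val.toLinearMap))
    (hS : ∀ x ∈ K, HopfAlgebra.antipode (R := k) x ∈ K)
    (hnormal : ∀ x ∈ K, ∀ a : H,
      adL k H x (Coalgebra.comul (R := k) a) ∈ K ∧
      adR k H x (Coalgebra.comul (R := k) a) ∈ K) :
    -- `HK⁺ = K⁺H`
    HKp k H K = KpH k H K ∧
    -- `HK⁺` is a two-sided ideal ...
    (∀ a ∈ HKp k H K, ∀ h : H, h * a ∈ HKp k H K ∧ a * h ∈ HKp k H K) ∧
    -- ... and a coideal of `H`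
    (∀ a ∈ HKp k H K, Coalgebra.comul (R := k) a ∈
      LinearMap.range (TensorProduct.map (HKp k H K).subtype LinearMap.id) ⊔
      LinearMap.range (TensorProduct.map LinearMap.id (HKp k H K).subtype)) ∧
    (∀ a ∈ HKp k H K, Coalgebra.counit (R := k) a = 0) ∧
    -- the Galois map `β̄` is well defined and bijective with the stated inverse
    (∃ βb : ((H ⊗[k] H) ⧸ relK k H K) →ₗ[k] H ⊗[k] (H ⧸ HKp k H K),
      (∀ x y : H, βb ((relK k H K).mkQ (x ⊗ₜ[k] y))
        = (LinearMap.lTensor H (HKp k H K).mkQ)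
            ((x ⊗ₜ[k] (1 : H)) * Coalgebra.comul (R := k) y)) ∧
      Function.Bijective βb ∧
      ∃ γ : H ⊗[k] (H ⧸ HKp k H K) →ₗ[k] ((H ⊗[k] H) ⧸ relK k H K),
        (∀ x y : H, γ (x ⊗ₜ[k] ((HKp k H K).mkQ y))
          = (relK k H K).mkQ ((x ⊗ₜ[k] (1 : H)) *
              (LinearMap.rTensor H (HopfAlgebra.antipode (R := k)))
                (Coalgebra.comul (R := k) y))) ∧
        (∀ q, γ (βb q) = q) ∧ (∀ z, βb (γ z) = z)) := by
  have hRL := HKp_le_KpH fun x hx a ↦ (hnormal x hx a).2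
  have hLR := KpH_le_HKp fun x hx a ↦ (hnormal x hx a).1
  have heq := le_antisymm hRL hLR
  refine ⟨heq, fun a ha h ↦ ⟨HKp_mul_mem_left ha h, ?_⟩, fun a ha ↦ comul_mem_of_mem_HKp hΔ ha,
    fun a ha ↦ counit_eq_zero_of_mem_HKp ha, ?_⟩
  · rw [heq] at ha ⊢
    exact KpH_mul_mem_right ha h
  let βb := (relK k H K).liftQ _ (relK_le_ker hLR hΔ)
  let γ : H ⊗[k] (H ⧸ HKp k H K) →ₗ[k] ((H ⊗[k] H) ⧸ relK k H K) :=
    TensorProduct.lift ((HKp k H K).liftQ _ (HKp_le_ker_mkQ_twistedCan hRL hΔ)).flip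
  have hβ (t : H ⊗[k] H) : βb ((relK k H K).mkQ t) =
      (HKp k H K).mkQ.lTensor H (twistedCan LinearMap.id t) := rfl
  have hγ (t : H ⊗[k] H) : γ ((HKp k H K).mkQ.lTensor H t) =
      (relK k H K).mkQ (twistedCan (HopfAlgebra.antipode k) t) := by
    induction t with
    | zero => simp
    | add s t hs ht => simp only [map_add, hs, ht]
    | tmul x y => rfl
  have hγβ (q) : γ (βb q) = q := by
    obtain ⟨t, rfl⟩ := (relK k H K).mkQ_surjective q
    rw [hβ, hγ, twistedCan_twistedCan HopfAlgebra.mul_antipode_lTensor_comul]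
  have hβγ (z) : βb (γ z) = z := by
    obtain ⟨t, rfl⟩ := LinearMap.lTensor_surjective H (HKp k H K).mkQ_surjective z
    rw [hγ, hβ, twistedCan_twistedCan HopfAlgebra.mul_antipode_rTensor_comul]
  refine ⟨βb, fun x y ↦ ?_, Function.bijective_iff_has_inverse.2 ⟨γ, hγβ, hβγ⟩, γ,
    fun x y ↦ rfl, hγβ, hβγ⟩
  rw [hβ, twistedCan_tmul, LinearMap.rTensor_id, LinearMap.id_apply]
end
end
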